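/- Let N ≥ 2, T > 0, α > 0, and let f : ℝ^N × (0,T) → ℝ be non-negative, bounded and measurable. Write x = (x₁, x′) ∈ ℝ × ℝ^{N−1}. Let s_0 : ℝ^{N−1} → ℝ be C² with bounded derivatives up to second order. Then there exists no pair (u, s), where s : (0,T) × ℝ^{N−1} → ℝ is C¹ in t and C² in x′ on (0,T), with s(t,·) → s_0 in the uniform C² topology as t ↓ 0, with s, ∇_{x′}s, ∇²_{x′}s bounded on ℝ^{N−1}×(0,T) and ṡ, ∇_{x′}s, ∇²_{x′}s bounded on ℝ^{N−1}×(δ,T) for each δ > 0, and where u is a non-negative bounded classical solution of ∂_t u − Δu = f on the moving domain D(t) = {(x₁,x′) : x₁ > s(t,x′)}, continuous together with ∇u up to the lateral boundary, satisfying the boundary conditions u = 0 and ∂u/∂ν = −α on the graph x₁ = s(t,x′) (ν the exterior unit normal of D(t)), and continuous up to t = 0 with u(·,0) ≡ 0. -/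

import Mathlib

set_option autoImplicit false
open Set Filter

lemma aux_second_deriv (g g1 : ℝ → ℝ) (x A : ℝ) (hg : ∀ y, HasDerivAt g (g1 y) y)
    (hg1 : HasDerivAt g1 A x) (hm : IsLocalMax g x) : A ≤ 0 := by
  by_contra hA
  push Not at hA
  have hd : deriv g = g1 := funext fun y => (hg y).deriv
  have h0 : deriv g x = 0 := hm.deriv_eq_zero
  have h2 : 0 < deriv (deriv g) x := by rw [hd, hg1.deriv]; exact hA
  have hmin := isLocalMin_of_deriv_deriv_pos h2 h0 (hg x).continuousAt
  have hc : g =ᶠ[nhds x] fun _ => g x := by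
    filter_upwards [hm, hmin] with y h1 h2
    exact le_antisymm h1 h2
  have h3 : deriv g =ᶠ[nhds x] fun _ => 0 := by
    have := hc.deriv
    simpa using this
  have h4 := h3.deriv_eq
  simp at h4
  linarith

lemma aux_time_deriv (g : ℝ → ℝ) (δ t C : ℝ) (hδ : δ < t) (hg : HasDerivAt g C t)
    (hm : ∀ τ ∈ Icc δ t, g τ ≤ g t) : 0 ≤ C := by
  by_contra hC
  push Not at hC
  have := hg.tendsto_slope
  have h1 : ∀ᶠ y in nhdsWithin t {t}ᶜ, slope g t y < 0 := this.eventually (gt_mem_nhds hC)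
  have h2 : ∀ᶠ y in nhdsWithin t (Iio t), slope g t y < 0 :=
    h1.filter_mono (nhdsWithin_mono _ (fun y hy => ne_of_lt hy))
  have h3 : ∀ᶠ y in nhdsWithin t (Iio t), y ∈ Ioo δ t := Ioo_mem_nhdsLT hδ
  obtain ⟨y, hy1, hy2⟩ := (h2.and h3).exists
  have := hm y ⟨hy2.1.le, hy2.2.le⟩
  rw [slope_def_field, div_neg_iff] at hy1
  rcases hy1 with h | h <;> linarith [hy2.2]

lemma aux_S (ε : ℝ) (hε : 0 < ε) : ∃ H S S' : ℝ → ℝ,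
    (∀ y, HasDerivAt H (S y) y) ∧ (∀ y, HasDerivAt S (S' y) y) ∧ Continuous S' ∧
    (∀ y, 0 ≤ S' y) ∧ (∀ y, 0 ≤ S y) ∧ (∀ y, S y ≤ 1) ∧ (∀ y ≤ ε, S y = 0) ∧
    (∀ y, 2 * ε ≤ y → S y = 1) ∧ (∀ y ≤ ε, H y = 0) ∧ (∀ y, 0 ≤ y → 0 ≤ H y) ∧
    (∀ y, 0 ≤ y → H y ≤ y) := by
  set S : ℝ → ℝ := fun y => Real.smoothTransition (y / ε - 1) with hS
  have hSd : ContDiff ℝ 1 S :=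
    Real.smoothTransition.contDiff.comp ((contDiff_id.div_const ε).sub contDiff_const)
  have hSc : Continuous S := hSd.continuous
  have hmono : Monotone S := by
    intro a b hab
    apply Real.smoothTransition.monotone
    gcongr
  have hz : ∀ y ≤ ε, S y = 0 := fun y hy => by
    apply Real.smoothTransition.zero_of_nonpos
    have : y / ε ≤ 1 := (div_le_one hε).2 hy
    linarith
  refine ⟨fun y => ∫ x in (0:ℝ)..y, S x, S, deriv S, ?_, ?_, ?_, ?_, ?_, ?_, hz, ?_, ?_, ?_, ?_⟩
  · intro y
    exact intervalIntegral.integral_hasDerivAt_right (hSc.intervalIntegrable _ _)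
      (hSc.stronglyMeasurableAtFilter _ _) hSc.continuousAt
  · intro y
    exact (hSd.differentiable (by norm_num) y).hasDerivAt
  · exact hSd.continuous_deriv (by norm_num)
  · intro y; exact hmono.deriv_nonneg
  · intro y; exact Real.smoothTransition.nonneg _
  · intro y; exact Real.smoothTransition.le_one _
  · intro y hy
    apply Real.smoothTransition.one_of_one_le
    have : 2 ≤ y / ε := (le_div_iff₀ hε).2 hy
    linarith
  · intro y hy
    show ∫ x in (0:ℝ)..y, S x = 0
    rw [intervalIntegral.integral_congr (g := fun _ => (0:ℝ))]
    · simp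
    · intro x hx
      apply hz
      rcases le_total 0 y with h | h
      · rw [uIcc_of_le h] at hx; linarith [hx.2]
      · rw [uIcc_of_ge h] at hx; linarith [hx.2]
  · intro y hy
    exact intervalIntegral.integral_nonneg hy fun x _ => Real.smoothTransition.nonneg _
  · intro y hy
    have := intervalIntegral.integral_mono_on hy (hSc.intervalIntegrable 0 y)
      (continuous_const.intervalIntegrable (μ := MeasureTheory.volume) 0 y (u := fun _ => (1:ℝ))) fun x _ => Real.smoothTransition.le_one _
    simpa using this

lemma aux_riemann (g : ℝ → ℝ) (hg : Continuous g) (a L e : ℝ) (K : ℕ) (hK : 0 < K) (hL : 0 ≤ L)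
    (hu : ∀ y ∈ Icc (a - L) a, ∀ y' ∈ Icc (a - L) a, |y - y'| ≤ L / K → g y' ≤ g y + e) :
    ∫ x in (a - L)..a, g x ≤ (∑ k ∈ Finset.range K, L / K * g (a - k * (L / K))) + L * e := by
  set h := L / K with hh
  have hK' : (0:ℝ) < K := by exact_mod_cast hK
  have hKh : K * h = L := by rw [hh]; field_simp
  have h0 : 0 ≤ h := by positivity
  have h1 := intervalIntegral.sum_integral_adjacent_intervals (f := g)
    (μ := MeasureTheory.volume) (a := fun k : ℕ => a - k * h) (n := K)
    (fun k _ => hg.intervalIntegrable _ _)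
  simp only [Nat.cast_zero, zero_mul, sub_zero, hKh] at h1
  have h2 : ∫ x in (a - L)..a, g x = ∑ k ∈ Finset.range K,
      ∫ x in (a - (k + 1 : ℕ) * h)..(a - k * h), g x := by
    rw [intervalIntegral.integral_symm, ← h1, ← Finset.sum_neg_distrib]
    refine Finset.sum_congr rfl fun k _ => ?_
    rw [← intervalIntegral.integral_symm]
  have h3 : L * e = ∑ k ∈ Finset.range K, h * e := by
    simp; rw [← hKh]; ring
  rw [h2, h3, ← Finset.sum_add_distrib]
  refine Finset.sum_le_sum fun k hk => ?_
  have hk' : (k:ℝ) + 1 ≤ K := by exact_mod_cast Finset.mem_range.1 hk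
  have hle : a - (k + 1 : ℕ) * h ≤ a - k * h := by push_cast; nlinarith
  have hkk : (k + 1) * h ≤ L := by rw [← hKh]; gcongr
  have hk0 : 0 ≤ k * h := by positivity
  have := intervalIntegral.integral_mono_on hle (hg.intervalIntegrable _ _)
      (continuous_const.intervalIntegrable (μ := MeasureTheory.volume) _ _ (u := fun _ => g (a - k*h) + e)) fun x hx => by
    have hx1 := hx.1
    have hx2 := hx.2
    push_cast at hx1
    refine hu _ ⟨?_, ?_⟩ _ ⟨?_, ?_⟩ ?_
    · nlinarith
    · linarith
    · linarith
    · linarith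
    · rw [abs_le]; constructor <;> linarith
  refine this.trans (le_of_eq ?_)
  simp
  ring

lemma aux_small {X : Type*} [PseudoMetricSpace X] (Kc : Set X) (hK : IsCompact Kc) (t1 : ℝ)
    (ht1 : 0 < t1) (U : X × ℝ → ℝ) (hU : ContinuousOn U (Kc ×ˢ Icc 0 t1))
    (h0 : ∀ x ∈ Kc, U (x, 0) = 0) (η : ℝ) (hη : 0 < η) :
    ∃ τ, 0 < τ ∧ τ ≤ t1 ∧ ∀ x ∈ Kc, ∀ t ∈ Icc 0 τ, U (x, t) ≤ η := by
  have huc := (hK.prod isCompact_Icc).uniformContinuousOn_of_continuous hU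
  rw [Metric.uniformContinuousOn_iff] at huc
  obtain ⟨d, hd, h⟩ := huc η hη
  refine ⟨min (d/2) t1, by positivity, min_le_right _ _, fun x hx t ht => ?_⟩
  have h1 : t ≤ d/2 := ht.2.trans (min_le_left _ _)
  have h2 : t ≤ t1 := ht.2.trans (min_le_right _ _)
  have := h (x, t) ⟨hx, ht.1, h2⟩ (x, 0) ⟨hx, le_rfl, ht1.le⟩ (by
    rw [Prod.dist_eq]; simp only [dist_self, Real.dist_eq, sub_zero, abs_of_nonneg ht.1]
    exact max_lt hd (by linarith))
  rw [h0 x hx, Real.dist_eq, sub_zero] at this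
  exact (le_abs_self _).trans this.le

lemma aux_max {n : ℕ} (W : ℝ → EuclideanSpace ℝ (Fin n) → ℝ → ℝ) (a ρ δ t0 k ω γ c0 : ℝ)
    (hρ : 0 < ρ) (hδ : δ < t0)
    (hW : ContinuousOn (fun p : ℝ × EuclideanSpace ℝ (Fin n) × ℝ => W p.1 p.2.1 p.2.2)
      (Icc (a - ρ) (a + ρ) ×ˢ (Metric.closedBall 0 ρ ×ˢ Icc δ t0)))
    (hd : ∀ x₁ ∈ Icc (a - ρ) (a + ρ), ∀ x' ∈ Metric.closedBall (0 : EuclideanSpace ℝ (Fin n)) ρ,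
      ∀ t ∈ Ioc δ t0, ∃ (W1 : ℝ → ℝ) (A : ℝ) (Wi : Fin n → ℝ → ℝ) (B : Fin n → ℝ) (C : ℝ),
        (∀ ξ, HasDerivAt (fun ξ => W ξ x' t) (W1 ξ) ξ) ∧ HasDerivAt W1 A x₁ ∧
        (∀ i, (∀ τ, HasDerivAt (fun τ : ℝ => W x₁ (x' + τ • EuclideanSpace.single i (1:ℝ)) t)
          (Wi i τ) τ)) ∧ (∀ i, HasDerivAt (Wi i) (B i) 0) ∧
        HasDerivAt (fun τ => W x₁ x' τ) C t ∧ C - A - ∑ i, B i ≤ -γ)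
    (hk : 0 ≤ k) (hω : 0 ≤ ω) 
    (hinit : ∀ x₁ ∈ Icc (a - ρ) (a + ρ), ∀ x' ∈ Metric.closedBall (0 : EuclideanSpace ℝ (Fin n)) ρ,
      W x₁ x' δ ≤ ω)
    (hlat : ∀ x₁ ∈ Icc (a - ρ) (a + ρ), ∀ x' ∈ Metric.closedBall (0 : EuclideanSpace ℝ (Fin n)) ρ,
      ∀ t ∈ Icc δ t0, W x₁ x' t + c0 * (t - δ) ≤ k * ρ ^ 2)
    (hγ : c0 + 2 * k * (n + 1) < γ) :
    W a 0 t0 ≤ ω - c0 * (t0 - δ) := by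
  set Ψ : ℝ × EuclideanSpace ℝ (Fin n) × ℝ → ℝ := fun p => W p.1 p.2.1 p.2.2 + c0 * (p.2.2 - δ)
    - k * ((p.1 - a) ^ 2 + ‖p.2.1‖ ^ 2) with hΨ
  have hΨc : ContinuousOn Ψ (Icc (a - ρ) (a + ρ) ×ˢ (Metric.closedBall 0 ρ ×ˢ Icc δ t0)) := by
    apply ContinuousOn.sub (hW.add ?_) ?_
    · exact Continuous.continuousOn (by fun_prop)
    · exact Continuous.continuousOn (by fun_prop)
  have hp0 : (a, (0 : EuclideanSpace ℝ (Fin n)), t0) ∈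
      (Icc (a - ρ) (a + ρ) ×ˢ (Metric.closedBall 0 ρ ×ˢ Icc δ t0)) :=
    ⟨⟨by simp; linarith, by simp; linarith⟩, by simp; linarith, hδ.le, le_rfl⟩
  obtain ⟨⟨y, y', t⟩, ⟨hy, hy', ht⟩, hmax⟩ := (isCompact_Icc.prod
    ((isCompact_closedBall _ _).prod isCompact_Icc)).exists_isMaxOn ⟨_, hp0⟩ hΨc
  simp only at hy hy' ht
  have key : Ψ (y, y', t) ≤ ω := by
    by_contra hcon
    push Not at hcon
    simp only [hΨ] at hcon
    have hsq1 : 0 ≤ k * (y - a) ^ 2 := by positivity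
    have hsq2 : 0 ≤ k * ‖y'‖ ^ 2 := by positivity
    have htδ : δ < t := by
      rcases ht.1.eq_or_lt with h | h
      · subst h
        have := hinit y hy y' hy'
        nlinarith
      · exact h
    have hl := hlat y hy y' hy' t ht
    have hyn : ‖y'‖ ≤ ρ := by simpa using hy'
    have hyi : y ∈ Ioo (a - ρ) (a + ρ) := by
      constructor
      · refine lt_of_le_of_ne hy.1 fun h => ?_
        have : (y - a) ^ 2 = ρ ^ 2 := by rw [← h]; ring
        rw [this] at hcon hsq1; nlinarith
      · refine lt_of_le_of_ne hy.2 fun h => ?_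
        have : (y - a) ^ 2 = ρ ^ 2 := by rw [h]; ring
        rw [this] at hcon hsq1; nlinarith
    have hyi' : ‖y'‖ < ρ := by
      refine lt_of_le_of_ne hyn fun h => ?_
      rw [h] at hcon hsq2; nlinarith
    obtain ⟨W1, A, Wi, B, C, h1, h11, h2, h22, h3, h4⟩ := hd y hy y' hy' t ⟨htδ, ht.2⟩
    have hA : A - 2 * k ≤ 0 := by
      refine aux_second_deriv (fun ξ => Ψ (ξ, y', t)) (fun ξ => W1 ξ - k * (2 * (ξ - a))) y _
        ?_ ?_ ?_
      · intro ξ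
        have e := ((h1 ξ).add_const (c0 * (t - δ))).sub
          (((((hasDerivAt_id ξ).sub_const a).pow 2).add_const (‖y'‖ ^ 2)).const_mul k)
        refine HasDerivAt.congr_deriv e ?_
        simp
      · have e := h11.sub ((((hasDerivAt_id y).sub_const a).const_mul 2).const_mul k)
        refine HasDerivAt.congr_deriv e ?_
        simp; ring
      · filter_upwards [Ioo_mem_nhds hyi.1 hyi.2] with ξ hξ
        exact hmax (show (ξ, y', t) ∈ _ from ⟨⟨hξ.1.le, hξ.2.le⟩, hy', ht⟩)
    have hB : ∀ i, B i - 2 * k ≤ 0 := by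
      intro i
      have hnorm : ∀ τ : ℝ, ‖y' + τ • EuclideanSpace.single i (1:ℝ)‖ ^ 2
          = ‖y'‖ ^ 2 + 2 * τ * y' i + τ ^ 2 := by
        intro τ
        rw [norm_add_sq_real, inner_smul_right, norm_smul]
        simp [EuclideanSpace.inner_single_right]
        ring
      refine aux_second_deriv (fun τ => Ψ (y, y' + τ • EuclideanSpace.single i (1:ℝ), t))
        (fun τ => Wi i τ - k * (2 * y' i + 2 * τ)) 0 _ ?_ ?_ ?_
      · intro τ
        simp only [hΨ, hnorm]
        have e := ((h2 i τ).add_const (c0 * (t - δ))).sub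
          (((((((hasDerivAt_id τ).const_mul 2).mul_const (y' i)).const_add (‖y'‖ ^ 2)).add
            ((hasDerivAt_id τ).pow 2)).const_add ((y - a) ^ 2)).const_mul k)
        refine HasDerivAt.congr_deriv e ?_
        simp
      · have e := (h22 i).sub ((((hasDerivAt_id (0:ℝ)).const_mul 2).const_add
          (2 * y' i)).const_mul k)
        refine HasDerivAt.congr_deriv e ?_
        simp; ring
      · have hc : ContinuousAt (fun τ : ℝ => ‖y' + τ • EuclideanSpace.single i (1:ℝ)‖) 0 := by
          fun_prop
        have := hc.eventually_lt (continuousAt_const (y := ρ)) (by simpa using hyi')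
        filter_upwards [this] with τ hτ
        have := hmax (show (y, y' + τ • EuclideanSpace.single i (1:ℝ), t) ∈ _ from
          ⟨hy, by simpa using hτ.le, ht⟩)
        simpa using this
    have hC : 0 ≤ C + c0 := by
      refine aux_time_deriv (fun τ => Ψ (y, y', τ)) δ t _ htδ ?_ ?_
      · have e := (h3.add (((hasDerivAt_id t).sub_const δ).const_mul c0)).sub_const
          (k * ((y - a) ^ 2 + ‖y'‖ ^ 2))
        refine HasDerivAt.congr_deriv e ?_
        simp
      · intro τ hτ
        exact hmax (show (y, y', τ) ∈ _ from ⟨hy, hy', hτ.1, hτ.2.trans ht.2⟩)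
    have hsum : ∑ i, B i ≤ n * (2 * k) := by
      have : ∑ i : Fin n, B i ≤ ∑ i : Fin n, 2 * k := Finset.sum_le_sum fun i _ => by
        linarith [hB i]
      simpa using this
    nlinarith
  have h5 : Ψ (a, 0, t0) ≤ Ψ (y, y', t) := hmax hp0
  simp only [hΨ] at h5 key
  simp at h5
  linarith

lemma aux_line1 (H S : ℝ → ℝ) (ε : ℝ) (hε : 0 < ε) (hH : ∀ y, HasDerivAt H (S y) y)
    (hS0 : ∀ y ≤ ε, S y = 0) (hH0 : ∀ y ≤ ε, H y = 0) (U : ℝ → ℝ) (d τ : ℝ)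
    (h : HasDerivAt U d τ ∨ (ContinuousAt U τ ∧ U τ = 0)) :
    HasDerivAt (fun x => H (U x)) (S (U τ) * d) τ := by
  rcases h with h | ⟨hc, h0⟩
  · exact (hH (U τ)).comp τ h
  · have hev : ∀ᶠ x in nhds τ, U x < ε := hc.eventually_lt continuousAt_const (by rw [h0]; exact hε)
    rw [h0, hS0 0 hε.le, zero_mul]
    refine (hasDerivAt_const τ (0:ℝ)).congr_of_eventuallyEq ?_
    filter_upwards [hev] with x hx
    exact hH0 _ hx.le

lemma aux_Sderiv_zero (S S' : ℝ → ℝ) (ε : ℝ) (hε : 0 < ε) (hS : ∀ y, HasDerivAt S (S' y) y)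
    (hS0 : ∀ y ≤ ε, S y = 0) : S' 0 = 0 := by
  refine (hS 0).unique ((hasDerivAt_const (0:ℝ) (0:ℝ)).congr_of_eventuallyEq ?_)
  filter_upwards [gt_mem_nhds hε] with x hx
  exact hS0 _ hx.le

lemma aux_line2 (S S' : ℝ → ℝ) (ε : ℝ) (hε : 0 < ε) (hS : ∀ y, HasDerivAt S (S' y) y)
    (hS0 : ∀ y ≤ ε, S y = 0) (U d : ℝ → ℝ) (e τ : ℝ)
    (h : (HasDerivAt U (d τ) τ ∧ HasDerivAt d e τ) ∨ (ContinuousAt U τ ∧ U τ = 0)) :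
    HasDerivAt (fun x => S (U x) * d x) (S' (U τ) * d τ ^ 2 + S (U τ) * e) τ := by
  rcases h with ⟨h, h2⟩ | ⟨hc, h0⟩
  · refine HasDerivAt.congr_deriv (((hS (U τ)).comp τ h).mul h2) ?_
    simp only [Function.comp]; ring
  · have hev : ∀ᶠ x in nhds τ, U x < ε := hc.eventually_lt continuousAt_const (by rw [h0]; exact hε)
    rw [h0, hS0 0 hε.le, aux_Sderiv_zero S S' ε hε hS hS0]
    simp only [zero_mul, add_zero]
    refine (hasDerivAt_const τ (0:ℝ)).congr_of_eventuallyEq ?_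
    filter_upwards [hev] with x hx
    simp [hS0 _ hx.le]

set_option maxHeartbeats 4000000 in
theorem core_false {n : ℕ} (T Mf c : ℝ) (hT : 0 < T) (hc : 0 < c) (hMf : 0 ≤ Mf)
    (f : ℝ → EuclideanSpace ℝ (Fin n) → ℝ → ℝ)
    (hf0 : ∀ x₁ x', ∀ t ∈ Ioo 0 T, 0 ≤ f x₁ x' t)
    (hf1 : ∀ x₁ x', ∀ t ∈ Ioo 0 T, f x₁ x' t ≤ Mf)
    (u : ℝ → EuclideanSpace ℝ (Fin n) → ℝ → ℝ)
    (s : ℝ → EuclideanSpace ℝ (Fin n) → ℝ)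
    (u₁ u₁₁ : ℝ → EuclideanSpace ℝ (Fin n) → ℝ → ℝ)
    (Du' : ℝ → EuclideanSpace ℝ (Fin n) → ℝ → (EuclideanSpace ℝ (Fin n) →L[ℝ] ℝ))
    (D2u' : ℝ → EuclideanSpace ℝ (Fin n) → ℝ →
      (EuclideanSpace ℝ (Fin n) →L[ℝ] EuclideanSpace ℝ (Fin n) →L[ℝ] ℝ))
    (hs : ContinuousOn (fun p : EuclideanSpace ℝ (Fin n) × ℝ => s p.2 p.1) (univ ×ˢ Ico 0 T))
    (hpde : ∀ t ∈ Ioo 0 T, ∀ x' : EuclideanSpace ℝ (Fin n), ∀ x₁ : ℝ, s t x' < x₁ →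
        HasDerivAt (fun ξ => u ξ x' t) (u₁ x₁ x' t) x₁ ∧
        HasDerivAt (fun ξ => u₁ ξ x' t) (u₁₁ x₁ x' t) x₁ ∧
        HasFDerivAt (fun y => u x₁ y t) (Du' x₁ x' t) x' ∧
        HasFDerivAt (fun y => Du' x₁ y t) (D2u' x₁ x' t) x' ∧
        HasDerivAt (fun τ => u x₁ x' τ)
          (u₁₁ x₁ x' t +
            (∑ i : Fin n,
              D2u' x₁ x' t (EuclideanSpace.single i (1 : ℝ))
                (EuclideanSpace.single i (1 : ℝ))) + f x₁ x' t) t)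
    (hpos : ∀ t ∈ Ioo 0 T, ∀ x' : EuclideanSpace ℝ (Fin n), ∀ x₁ : ℝ,
        s t x' ≤ x₁ → 0 ≤ u x₁ x' t)
    (hu : ContinuousOn (fun p : ℝ × EuclideanSpace ℝ (Fin n) × ℝ => u p.1 p.2.1 p.2.2)
        {p : ℝ × EuclideanSpace ℝ (Fin n) × ℝ |
          p.2.2 ∈ Ico 0 T ∧ s p.2.2 p.2.1 ≤ p.1})
    (hu₁ : ContinuousOn (fun p : ℝ × EuclideanSpace ℝ (Fin n) × ℝ => u₁ p.1 p.2.1 p.2.2)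
        {p : ℝ × EuclideanSpace ℝ (Fin n) × ℝ |
          p.2.2 ∈ Ioo 0 T ∧ s p.2.2 p.2.1 ≤ p.1})
    (hdir : ∀ t ∈ Ioo 0 T, ∀ x' : EuclideanSpace ℝ (Fin n), u (s t x') x' t = 0)
    (hneu : ∀ t ∈ Ioo 0 T, ∀ x' : EuclideanSpace ℝ (Fin n), c ≤ u₁ (s t x') x' t)
    (hini : ∀ x' : EuclideanSpace ℝ (Fin n), ∀ x₁ : ℝ, s 0 x' ≤ x₁ → u x₁ x' 0 = 0) :
    False := by
  set U : ℝ → EuclideanSpace ℝ (Fin n) → ℝ → ℝ := fun x₁ x' t => u (max x₁ (s t x')) x' t with hUdef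
  set U₁ : ℝ → EuclideanSpace ℝ (Fin n) → ℝ → ℝ := fun x₁ x' t => u₁ (max x₁ (s t x')) x' t
    with hU₁def
  have hmaxc : ContinuousOn (fun p : ℝ × EuclideanSpace ℝ (Fin n) × ℝ =>
      ((max p.1 (s p.2.2 p.2.1), p.2.1, p.2.2) : ℝ × EuclideanSpace ℝ (Fin n) × ℝ))
      {p | p.2.2 ∈ Ico 0 T} := by
    have h1 : ContinuousOn (fun p : ℝ × EuclideanSpace ℝ (Fin n) × ℝ => s p.2.2 p.2.1)
      {p | p.2.2 ∈ Ico 0 T} :=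
      hs.comp (f := fun p : ℝ × EuclideanSpace ℝ (Fin n) × ℝ => p.2) continuousOn_snd
        (fun p hp => ⟨mem_univ _, hp⟩)
    exact (continuousOn_fst.sup h1).prodMk continuousOn_snd
  have hUc : ContinuousOn (fun p : ℝ × EuclideanSpace ℝ (Fin n) × ℝ => U p.1 p.2.1 p.2.2)
      {p | p.2.2 ∈ Ico 0 T} :=
    hu.comp hmaxc (fun p hp => ⟨hp, le_max_right _ _⟩)
  have hU₁c : ContinuousOn (fun p : ℝ × EuclideanSpace ℝ (Fin n) × ℝ => U₁ p.1 p.2.1 p.2.2)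
      {p | p.2.2 ∈ Ioo 0 T} :=
    hu₁.comp (hmaxc.mono fun p hp => ⟨hp.1.le, hp.2⟩) (fun p hp => ⟨hp, le_max_right _ _⟩)
  have hopen : IsOpen {p : ℝ × EuclideanSpace ℝ (Fin n) × ℝ | p.2.2 ∈ Ioo 0 T} :=
    isOpen_Ioo.preimage (continuous_snd.comp continuous_snd)
  have hUat : ∀ x₁ x', ∀ t ∈ Ioo 0 T, ContinuousAt
      (fun p : ℝ × EuclideanSpace ℝ (Fin n) × ℝ => U p.1 p.2.1 p.2.2) (x₁, x', t) :=
    fun x₁ x' t ht => (hUc.mono fun p hp => ⟨hp.1.le, hp.2⟩).continuousAt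
      (hopen.mem_nhds (show (x₁, x', t) ∈ {p : ℝ × EuclideanSpace ℝ (Fin n) × ℝ |
        p.2.2 ∈ Ioo 0 T} from ht))
  have hsat : ∀ x', ∀ t ∈ Ioo 0 T, ContinuousAt
      (fun p : EuclideanSpace ℝ (Fin n) × ℝ => s p.2 p.1) (x', t) := by
    intro x' t ht
    refine hs.continuousAt (prod_mem_nhds univ_mem (Ico_mem_nhds ht.1 ht.2))
  have hUD : ∀ x₁ x' t, s t x' ≤ x₁ → U x₁ x' t = u x₁ x' t := fun x₁ x' t h => by
    simp only [hUdef, max_eq_left h]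
  have hU₁D : ∀ x₁ x' t, s t x' ≤ x₁ → U₁ x₁ x' t = u₁ x₁ x' t := fun x₁ x' t h => by
    simp only [hU₁def, max_eq_left h]
  have hU0 : ∀ x₁ x', ∀ t ∈ Ioo 0 T, x₁ ≤ s t x' → U x₁ x' t = 0 := fun x₁ x' t ht h => by
    simp only [hUdef, max_eq_right h]; exact hdir t ht x'
  have hUpos : ∀ x₁ x', ∀ t ∈ Ioo 0 T, 0 ≤ U x₁ x' t := fun x₁ x' t ht =>
    hpos t ht x' _ (le_max_right _ _)
  have hUt0 : ∀ x₁ x', U x₁ x' 0 = 0 := fun x₁ x' => hini x' _ (le_max_right _ _)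
  have hl1 : ∀ x', ∀ t ∈ Ioo 0 T, ∀ ξ, (HasDerivAt (fun ξ => U ξ x' t) (U₁ ξ x' t) ξ ∧
      HasDerivAt (fun ξ => U₁ ξ x' t) (u₁₁ ξ x' t) ξ) ∨
      (ContinuousAt (fun ξ => U ξ x' t) ξ ∧ U ξ x' t = 0) := by
    intro x' t ht ξ
    rcases lt_or_ge (s t x') ξ with h | h
    · left
      obtain ⟨h1, h2, -⟩ := hpde t ht x' ξ h
      rw [hU₁D _ _ _ h.le]
      constructor
      · refine h1.congr_of_eventuallyEq ?_
        filter_upwards [lt_mem_nhds h] with y hy using hUD _ _ _ hy.le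
      · refine h2.congr_of_eventuallyEq ?_
        filter_upwards [lt_mem_nhds h] with y hy using hU₁D _ _ _ hy.le
    · right
      refine ⟨?_, hU0 _ _ _ ht h⟩
      exact ContinuousAt.comp (f := fun ξ : ℝ => (ξ, x', t)) (hUat ξ x' t ht) (by fun_prop)
  have hl2 : ∀ x₁ x', ∀ t ∈ Ioo 0 T, ∀ (i : Fin n) (τ : ℝ),
      (HasDerivAt (fun τ : ℝ => U x₁ (x' + τ • EuclideanSpace.single i (1:ℝ)) t)
        (Du' x₁ (x' + τ • EuclideanSpace.single i (1:ℝ)) t (EuclideanSpace.single i (1:ℝ))) τ ∧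
      HasDerivAt (fun τ : ℝ => Du' x₁ (x' + τ • EuclideanSpace.single i (1:ℝ)) t
          (EuclideanSpace.single i (1:ℝ)))
        (D2u' x₁ (x' + τ • EuclideanSpace.single i (1:ℝ)) t (EuclideanSpace.single i (1:ℝ))
          (EuclideanSpace.single i (1:ℝ))) τ) ∨
      (ContinuousAt (fun τ : ℝ => U x₁ (x' + τ • EuclideanSpace.single i (1:ℝ)) t) τ ∧
        U x₁ (x' + τ • EuclideanSpace.single i (1:ℝ)) t = 0) := by
    intro x₁ x' t ht i τ
    set e := EuclideanSpace.single i (1:ℝ) with he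
    have hline : HasDerivAt (fun τ : ℝ => x' + τ • e) e τ := by
      have := ((hasDerivAt_id τ).smul_const e).const_add x'
      simpa using this
    rcases lt_or_ge (s t (x' + τ • e)) x₁ with h | h
    · left
      obtain ⟨-, -, h1, h2, -⟩ := hpde t ht (x' + τ • e) x₁ h
      constructor
      · refine (h1.comp_hasDerivAt τ hline).congr_of_eventuallyEq ?_
        have hcs : ContinuousAt (fun τ : ℝ => s t (x' + τ • e)) τ :=
          ContinuousAt.comp (f := fun τ : ℝ => (x' + τ • e, t)) (hsat (x' + τ • e) t ht)
            (by fun_prop)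
        filter_upwards [hcs.eventually_lt continuousAt_const h] with y hy using hUD _ _ _ hy.le
      · have h3 := h2.comp_hasDerivAt τ hline
        have := h3.clm_apply (hasDerivAt_const τ e)
        simpa using this
    · right
      refine ⟨?_, hU0 _ _ _ ht h⟩
      exact ContinuousAt.comp (f := fun τ : ℝ => (x₁, x' + τ • e, t)) (hUat x₁ (x' + τ • e) t ht)
        (by fun_prop)
  have hl3 : ∀ x₁ x', ∀ t ∈ Ioo 0 T,
      HasDerivAt (fun τ => U x₁ x' τ) (u₁₁ x₁ x' t +
            (∑ i : Fin n,
              D2u' x₁ x' t (EuclideanSpace.single i (1 : ℝ))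
                (EuclideanSpace.single i (1 : ℝ))) + f x₁ x' t) t ∨
      (ContinuousAt (fun τ => U x₁ x' τ) t ∧ U x₁ x' t = 0) := by
    intro x₁ x' t ht
    rcases lt_or_ge (s t x') x₁ with h | h
    · left
      refine (hpde t ht x' x₁ h).2.2.2.2.congr_of_eventuallyEq ?_
      have hcs : ContinuousAt (fun τ : ℝ => s τ x') t :=
          ContinuousAt.comp (f := fun τ : ℝ => (x', τ)) (hsat x' t ht) (by fun_prop)
      filter_upwards [hcs.eventually_lt continuousAt_const h] with y hy using hUD _ _ _ hy.le
    · right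
      refine ⟨?_, hU0 _ _ _ ht h⟩
      exact ContinuousAt.comp (f := fun τ : ℝ => (x₁, x', τ)) (hUat x₁ x' t ht) (by fun_prop)
  set z := s 0 0 with hz
  obtain ⟨r, hr, hrM⟩ : ∃ r : ℝ, 0 < r ∧ 6 * r * Mf ≤ c / 16 := by
    refine ⟨c / (96 * (Mf + 1)), by positivity, ?_⟩
    rw [show 6 * (c / (96 * (Mf + 1))) * Mf = c / 16 * (Mf / (Mf + 1)) by field_simp; ring]
    have : Mf / (Mf + 1) ≤ 1 := (div_le_one (by linarith)).2 (by linarith)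
    nlinarith
  obtain ⟨ρ, t1, hρ, hρr, ht1, ht1T, hsr⟩ : ∃ ρ t1 : ℝ, 0 < ρ ∧ ρ ≤ r ∧ 0 < t1 ∧ t1 < T ∧
      ∀ x' ∈ Metric.closedBall (0 : EuclideanSpace ℝ (Fin n)) ρ, ∀ t ∈ Icc 0 t1,
        |s t x' - z| < r := by
    have h0 := hs (0, 0) ⟨mem_univ _, le_rfl, hT⟩
    obtain ⟨d, hd, h⟩ := Metric.continuousWithinAt_iff.1 h0 r hr
    refine ⟨min r (d/2), min (T/2) (d/2), by positivity, min_le_left _ _, by positivity,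
      (min_le_left _ _).trans_lt (by linarith), fun x' hx' t ht => ?_⟩
    have h1 : t ≤ T / 2 := ht.2.trans (min_le_left _ _)
    have h2 : t ≤ d / 2 := ht.2.trans (min_le_right _ _)
    have h3 : ‖x'‖ ≤ d / 2 := by
      have : ‖x'‖ ≤ min r (d/2) := by simpa using hx'
      exact this.trans (min_le_right _ _)
    have := h (x := (x', t)) ⟨mem_univ _, ht.1, by show t < T; linarith⟩ (by
      rw [Prod.dist_eq]
      simp only [dist_zero_right, Real.norm_eq_abs, abs_of_nonneg ht.1]
      exact max_lt (by linarith) (by linarith))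
    simpa [Real.dist_eq] using this
  set a := z + 3 * r with ha
  set L := 6 * r with hL
  have hL0 : 0 < L := by positivity
  set γ := c / 4 with hγ
  set k := c / (32 * (n + 1)) with hk
  have hn0 : (0:ℝ) < n + 1 := by positivity
  have hk0 : 0 < k := by positivity
  have hkn : 2 * k * (n + 1) = c / 16 := by rw [hk]; field_simp; norm_num
  set c0 := c / 8 with hc0
  set Bx : Set (ℝ × EuclideanSpace ℝ (Fin n)) :=
    Icc (z - 4 * r) (z + 4 * r) ×ˢ Metric.closedBall 0 ρ with hBx
  have hBxc : IsCompact Bx := isCompact_Icc.prod (isCompact_closedBall _ _)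
  have hsmall : ∀ η > 0, ∃ τ, 0 < τ ∧ τ ≤ t1 ∧ ∀ x₁ ∈ Icc (z - 4 * r) (z + 4 * r),
      ∀ x' ∈ Metric.closedBall (0 : EuclideanSpace ℝ (Fin n)) ρ, ∀ t ∈ Icc 0 τ,
        U x₁ x' t ≤ η := by
    intro η hη
    obtain ⟨τ, h1, h2, h3⟩ := aux_small Bx hBxc t1 ht1
      (fun q => U q.1.1 q.1.2 q.2) (by
        refine hUc.comp (f := fun q : (ℝ × EuclideanSpace ℝ (Fin n)) × ℝ =>
          ((q.1.1, q.1.2, q.2) : ℝ × EuclideanSpace ℝ (Fin n) × ℝ))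
          (Continuous.continuousOn (by fun_prop)) ?_
        rintro q ⟨-, hq⟩
        exact ⟨hq.1, hq.2.trans_lt ht1T⟩) (fun x _ => hUt0 _ _) η hη
    exact ⟨τ, h1, h2, fun x₁ hx₁ x' hx' t ht => h3 (x₁, x') ⟨hx₁, hx'⟩ t ht⟩
  obtain ⟨t2, ht2, ht21, hUt2⟩ := hsmall (k * ρ ^ 2 / (2 * L)) (by positivity)
  obtain ⟨t0, ht0, ht02, hct0⟩ : ∃ t0, 0 < t0 ∧ t0 ≤ t2 ∧ c0 * t0 ≤ k * ρ ^ 2 / 2 := by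
    refine ⟨min t2 (k * ρ ^ 2 / 2 / c0), by positivity, min_le_left _ _, ?_⟩
    rw [← le_div_iff₀' (by positivity)]
    exact min_le_right _ _
  obtain ⟨t3, ht3, ht31, hUt3⟩ := hsmall (c0 * t0 / 4 / L) (by positivity)
  obtain ⟨δ, hδ, hδ3, hδ0⟩ : ∃ δ, 0 < δ ∧ δ ≤ t3 ∧ δ ≤ t0 / 4 :=
    ⟨min t3 (t0 / 4), by positivity, min_le_left _ _, min_le_right _ _⟩
  have htT : ∀ t ∈ Icc δ t0, t ∈ Ioo 0 T := fun t ht =>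
    ⟨by linarith [ht.1], by linarith [ht.2]⟩
  set Q : Set (ℝ × EuclideanSpace ℝ (Fin n) × ℝ) :=
    Icc (z - 4 * r) (z + 4 * r) ×ˢ (Metric.closedBall 0 ρ ×ˢ Icc δ t0) with hQ
  have hQc : IsCompact Q := isCompact_Icc.prod ((isCompact_closedBall _ _).prod isCompact_Icc)
  have hQT : Q ⊆ {p | p.2.2 ∈ Ioo 0 T} := fun p hp => htT _ hp.2.2
  obtain ⟨η, hη, hηr, hηU⟩ : ∃ η > 0, η ≤ r ∧
      ∀ x' ∈ Metric.closedBall (0 : EuclideanSpace ℝ (Fin n)) ρ, ∀ t ∈ Icc δ t0,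
        ∀ y ∈ Icc (s t x') (s t x' + η), c / 2 ≤ U₁ y x' t := by
    have huc := hQc.uniformContinuousOn_of_continuous (hU₁c.mono hQT)
    rw [Metric.uniformContinuousOn_iff] at huc
    obtain ⟨d, hd, h⟩ := huc (c/2) (by positivity)
    refine ⟨min r (d/2), by positivity, min_le_left _ _, fun x' hx' t ht y hy => ?_⟩
    have h1 := abs_lt.1 (hsr x' hx' t ⟨by linarith [ht.1], by linarith [ht.2]⟩)
    have h2 : y ≤ s t x' + r := hy.2.trans (by gcongr; exact min_le_left _ _)
    have h3 : y ≤ s t x' + d/2 := hy.2.trans (by gcongr; exact min_le_right _ _)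
    have hy1 := hy.1
    have := h (y, x', t) ⟨⟨by linarith, by linarith⟩, hx', ht⟩ (s t x', x', t)
      ⟨⟨by linarith, by linarith⟩, hx', ht⟩ (by
        simp only [Prod.dist_eq, dist_self, Real.dist_eq]
        refine max_lt ?_ (by simpa using hd)
        rw [abs_of_nonneg (by linarith)]; linarith)
    rw [Real.dist_eq] at this
    have h4 := (abs_lt.1 this).1
    rw [hU₁D (s t x') _ _ le_rfl] at h4
    have := hneu t (htT t ht) x'
    linarith
  set ε := c * η / 4 with hε
  have hε0 : 0 < ε := by positivity
  obtain ⟨H, S, S', hHd, hSd, hSderiv_cont, hSderiv_nonneg, hS0, hS1, hSz, hSo, hHz, hH0, hH1⟩ := aux_S ε hε0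
  set g : ℝ → EuclideanSpace ℝ (Fin n) → ℝ → ℝ := fun x₁ x' t =>
    S' (U x₁ x' t) * U₁ x₁ x' t ^ 2 with hg
  have hSc : Continuous S := continuous_iff_continuousAt.2 fun y => (hSd y).continuousAt
  have hHc : Continuous H := continuous_iff_continuousAt.2 fun y => (hHd y).continuousAt
  have hgc : ContinuousOn (fun p : ℝ × EuclideanSpace ℝ (Fin n) × ℝ => g p.1 p.2.1 p.2.2)
      {p | p.2.2 ∈ Ioo 0 T} :=
    (hSderiv_cont.comp_continuousOn (hUc.mono fun p hp => ⟨hp.1.le, hp.2⟩)).mul (hU₁c.pow 2)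
  have hg0 : ∀ x₁ x' t, 0 ≤ g x₁ x' t := fun x₁ x' t => mul_nonneg (hSderiv_nonneg _) (sq_nonneg _)
  obtain ⟨K, hK, hKg⟩ : ∃ K : ℕ, 0 < K ∧
      ∀ x' ∈ Metric.closedBall (0 : EuclideanSpace ℝ (Fin n)) ρ, ∀ t ∈ Icc δ t0,
        ∀ y ∈ Icc (z - 4 * r) (z + 4 * r), ∀ y' ∈ Icc (z - 4 * r) (z + 4 * r),
        |y - y'| ≤ L / K → g y' x' t ≤ g y x' t + c / 8 / L := by
    have huc := hQc.uniformContinuousOn_of_continuous (hgc.mono hQT)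
    rw [Metric.uniformContinuousOn_iff] at huc
    obtain ⟨d, hd, h⟩ := huc (c / 8 / L) (by positivity)
    obtain ⟨K, hK⟩ := exists_nat_gt (L / d)
    have hK0 : (0:ℝ) < K := lt_trans (by positivity) hK
    refine ⟨K, by exact_mod_cast hK0, fun x' hx' t ht y hy y' hy' hyy => ?_⟩
    have hLK : L / K < d := by
      rw [div_lt_iff₀ hd] at hK
      rw [div_lt_iff₀ hK0]; linarith
    have := h (y, x', t) ⟨hy, hx', ht⟩ (y', x', t) ⟨hy', hx', ht⟩ (by
        simp only [Prod.dist_eq, dist_self, Real.dist_eq]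
        exact max_lt (by linarith) (by simpa using hd))
    rw [Real.dist_eq] at this
    have h4 := (abs_lt.1 this).1
    linarith
  have hK' : (0:ℝ) < K := by exact_mod_cast hK
  set h := L / K with hh
  have hh0 : 0 < h := by positivity
  have hKh : K * h = L := by rw [hh]; field_simp
  set W : ℝ → EuclideanSpace ℝ (Fin n) → ℝ → ℝ := fun x₁ x' t =>
    ∑ j ∈ Finset.range K, h * H (U (x₁ - j * h) x' t) with hW
  have hsink : ∀ x₁ ∈ Icc (a - ρ) (a + ρ),
      ∀ x' ∈ Metric.closedBall (0 : EuclideanSpace ℝ (Fin n)) ρ, ∀ t ∈ Icc δ t0,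
      3 * c / 8 ≤ ∑ j ∈ Finset.range K, h * g (x₁ - j * h) x' t := by
    intro x₁ hx₁ x' hx' t ht
    have htt := htT t ht
    have h1 := abs_lt.1 (hsr x' hx' t ⟨by linarith [ht.1], by linarith [ht.2]⟩)
    have hx1 := hx₁.1
    have hx2 := hx₁.2
    have hgl : Continuous fun y => g y x' t :=
      continuousOn_univ.1 (hgc.comp (f := fun y : ℝ => (y, x', t))
        (Continuous.continuousOn (by fun_prop)) (fun y _ => htt))
    have hU₁l : Continuous fun y => U₁ y x' t :=
      continuousOn_univ.1 (hU₁c.comp (f := fun y : ℝ => (y, x', t))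
        (Continuous.continuousOn (by fun_prop)) (fun y _ => htt))
    have hUl : Continuous fun y => U y x' t :=
      continuousOn_univ.1 (hUc.comp (f := fun y : ℝ => (y, x', t))
        (Continuous.continuousOn (by fun_prop)) (fun y _ => ⟨htt.1.le, htt.2⟩))
    have h2 := aux_riemann (fun y => g y x' t) hgl x₁ L (c / 8 / L) K hK hL0.le
      (fun y hy y' hy' hyy => hKg x' hx' t ht y ⟨by linarith [hy.1], by linarith [hy.2]⟩ y'
        ⟨by linarith [hy'.1], by linarith [hy'.2]⟩ hyy)
    have h3 : L * (c / 8 / L) = c / 8 := by field_simp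
    have h4 : ∫ y in (s t x')..(s t x' + η), g y x' t ≤ ∫ y in (x₁ - L)..x₁, g y x' t := by
      apply intervalIntegral.integral_mono_interval
      · linarith
      · linarith
      · linarith
      · exact Eventually.of_forall fun y => hg0 y x' t
      · exact hgl.intervalIntegrable _ _
    set q : ℝ → ℝ := fun y => S' (U y x' t) * U₁ y x' t with hq
    have hqc : Continuous q := (hSderiv_cont.comp hUl).mul hU₁l
    have h5 : ∫ y in (s t x')..(s t x' + η), c / 2 * q y ≤
        ∫ y in (s t x')..(s t x' + η), g y x' t := by
      refine intervalIntegral.integral_mono_on (by linarith)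
        ((continuous_const.mul hqc).intervalIntegrable _ _) (hgl.intervalIntegrable _ _) ?_
      intro y hy
      have e1 := hηU x' hx' t ht y hy
      have e2 := hSderiv_nonneg (U y x' t)
      simp only [hq, hg]
      nlinarith [mul_nonneg (mul_nonneg e2 (by linarith : 0 ≤ U₁ y x' t)) (sub_nonneg.2 e1)]
    have h6 : ∫ y in (s t x')..(s t x' + η), q y = 1 := by
      have e1 : ∀ y, HasDerivAt (fun y => S (U y x' t)) (q y) y := by
        intro y
        refine aux_line1 S S' (ε/2) (by positivity) hSd ?_ ?_ (fun y => U y x' t) (U₁ y x' t) y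
          ((hl1 x' t htt y).imp And.left id)
        · intro w hw
          refine (hSd w).unique ((hasDerivAt_const w (0:ℝ)).congr_of_eventuallyEq ?_)
          filter_upwards [gt_mem_nhds (show w < ε by linarith)] with v hv using hSz v hv.le
        · intro w hw; exact hSz w (by linarith)
      rw [intervalIntegral.integral_eq_sub_of_hasDerivAt (fun y _ => e1 y)
        (hqc.intervalIntegrable _ _), hU0 _ _ _ htt le_rfl, hSz 0 hε0.le, sub_zero]
      apply hSo
      obtain ⟨ξ, hξ, hξe⟩ := exists_hasDerivAt_eq_slope (fun y => U y x' t) (fun y => u₁ y x' t)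
        (show s t x' < s t x' + η by linarith) hUl.continuousOn (by
          intro y hy
          refine (hpde t htt x' y hy.1).1.congr_of_eventuallyEq ?_
          filter_upwards [lt_mem_nhds hy.1] with v hv using hUD _ _ _ hv.le)
      have e3 := hηU x' hx' t ht ξ ⟨hξ.1.le, hξ.2.le⟩
      rw [hU₁D _ _ _ hξ.1.le, hξe, hU0 (s t x') x' t htt le_rfl, add_sub_cancel_left, sub_zero,
        le_div_iff₀ hη] at e3
      rw [hε]; linarith
    rw [intervalIntegral.integral_const_mul, h6] at h5
    linarith
  have hWle : ∀ m, ∀ x₁ ∈ Icc (a - ρ) (a + ρ), ∀ x', ∀ t ∈ Icc δ t0,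
      (∀ y ∈ Icc (z - 4 * r) (z + 4 * r), U y x' t ≤ m) → W x₁ x' t ≤ L * m := by
    intro m x₁ hx₁ x' t ht hm
    have : W x₁ x' t ≤ ∑ j ∈ Finset.range K, h * m := by
      refine Finset.sum_le_sum fun j hj => ?_
      have hj' : (j:ℝ) ≤ K := by exact_mod_cast (Finset.mem_range.1 hj).le
      have hjh : j * h ≤ L := by rw [← hKh]; gcongr
      have hj0 : 0 ≤ j * h := by positivity
      gcongr
      refine (hH1 _ (hUpos _ _ _ (htT t ht))).trans (hm _ ⟨?_, ?_⟩)
      · linarith [hx₁.1]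
      · linarith [hx₁.2]
    refine this.trans (le_of_eq ?_)
    simp; rw [← hKh]; ring
  have hfin := aux_max W a ρ δ t0 k (c0 * t0 / 4) γ c0 hρ (by linarith) ?_ ?_ hk0.le (by positivity)
    ?_ ?_ ?_
  · have hW0 : 0 ≤ W a 0 t0 := Finset.sum_nonneg fun j _ =>
      mul_nonneg hh0.le (hH0 _ (hUpos _ _ _ (htT t0 ⟨by linarith, le_rfl⟩)))
    nlinarith [mul_pos (show 0 < c0 by positivity) ht0]
  · refine continuousOn_finsetSum _ fun j _ => ContinuousOn.mul continuousOn_const ?_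
    refine hHc.comp_continuousOn (hUc.comp (f := fun p : ℝ × EuclideanSpace ℝ (Fin n) × ℝ =>
      ((p.1 - j * h, p.2.1, p.2.2) : ℝ × EuclideanSpace ℝ (Fin n) × ℝ))
      (Continuous.continuousOn (by fun_prop)) ?_)
    rintro p ⟨-, -, hp⟩
    exact ⟨(htT _ hp).1.le, (htT _ hp).2⟩
  · intro x₁ hx₁ x' hx' t ht
    have htt := htT t ⟨ht.1.le, ht.2⟩
    refine ⟨fun ξ => ∑ j ∈ Finset.range K, h * (S (U (ξ - j * h) x' t) * U₁ (ξ - j * h) x' t),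
      ∑ j ∈ Finset.range K, h * (S' (U (x₁ - j * h) x' t) * U₁ (x₁ - j * h) x' t ^ 2 +
        S (U (x₁ - j * h) x' t) * u₁₁ (x₁ - j * h) x' t),
      fun i τ => ∑ j ∈ Finset.range K, h * (
        S (U (x₁ - j * h) (x' + τ • EuclideanSpace.single i (1:ℝ)) t) *
        Du' (x₁ - j * h) (x' + τ • EuclideanSpace.single i (1:ℝ)) t
          (EuclideanSpace.single i (1:ℝ))),
      fun i => ∑ j ∈ Finset.range K, h * (S' (U (x₁ - j * h) x' t) *
          (Du' (x₁ - j * h) x' t (EuclideanSpace.single i (1:ℝ))) ^ 2 +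
        S (U (x₁ - j * h) x' t) * D2u' (x₁ - j * h) x' t (EuclideanSpace.single i (1:ℝ))
          (EuclideanSpace.single i (1:ℝ))),
      ∑ j ∈ Finset.range K, h * (S (U (x₁ - j * h) x' t) * (u₁₁ (x₁ - j * h) x' t +
            (∑ i : Fin n,
              D2u' (x₁ - j * h) x' t (EuclideanSpace.single i (1 : ℝ))
                (EuclideanSpace.single i (1 : ℝ))) + f (x₁ - j * h) x' t)),
      ?_, ?_, ?_, ?_, ?_, ?_⟩
    · intro ξ
      refine HasDerivAt.fun_sum fun j _ => HasDerivAt.const_mul h ?_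
      have e := aux_line1 H S ε hε0 hHd hSz hHz (fun ξ => U ξ x' t) (U₁ (ξ - j * h) x' t)
        (ξ - j * h) ((hl1 x' t htt (ξ - j * h)).imp And.left id)
      exact HasDerivAt.comp_sub_const ξ (j * h) e
    · refine HasDerivAt.fun_sum fun j _ => HasDerivAt.const_mul h ?_
      have e := aux_line2 S S' ε hε0 hSd hSz (fun ξ => U ξ x' t) (fun ξ => U₁ ξ x' t)
        (u₁₁ (x₁ - j * h) x' t) (x₁ - j * h) (hl1 x' t htt (x₁ - j * h))
      exact HasDerivAt.comp_sub_const x₁ (j * h) e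
    · intro i τ
      refine HasDerivAt.fun_sum fun j _ => HasDerivAt.const_mul h ?_
      exact aux_line1 H S ε hε0 hHd hSz hHz _ _ τ ((hl2 (x₁ - j * h) x' t htt i τ).imp And.left id)
    · intro i
      refine HasDerivAt.fun_sum fun j _ => HasDerivAt.const_mul h ?_
      have e := aux_line2 S S' ε hε0 hSd hSz
        (fun τ : ℝ => U (x₁ - j * h) (x' + τ • EuclideanSpace.single i (1:ℝ)) t)
        (fun τ : ℝ => Du' (x₁ - j * h) (x' + τ • EuclideanSpace.single i (1:ℝ)) t
          (EuclideanSpace.single i (1:ℝ))) _ 0 (hl2 (x₁ - j * h) x' t htt i 0)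
      simpa using e
    · refine HasDerivAt.fun_sum fun j _ => HasDerivAt.const_mul h ?_
      exact aux_line1 H S ε hε0 hHd hSz hHz _ _ t (hl3 (x₁ - j * h) x' t htt)
    · have hs1 := hsink x₁ hx₁ x' hx' t ⟨ht.1.le, ht.2⟩
      rw [Finset.sum_comm, ← Finset.sum_sub_distrib, ← Finset.sum_sub_distrib]
      refine (Finset.sum_le_sum (g := fun j : ℕ => h * Mf - h * g (x₁ - j * h) x' t)
        fun j _ => ?_).trans ?_
      · refine le_of_eq_of_le (b := h * (S (U (x₁ - j * h) x' t) * f (x₁ - j * h) x' t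
          - g (x₁ - j * h) x' t - S' (U (x₁ - j * h) x' t) * ∑ i : Fin n,
          (Du' (x₁ - j * h) x' t (EuclideanSpace.single i (1:ℝ))) ^ 2)) ?_ ?_
        · rw [← Finset.mul_sum, Finset.sum_add_distrib, ← Finset.mul_sum, ← Finset.mul_sum]
          simp only [hg]
          ring
        · rw [← mul_sub]
          refine mul_le_mul_of_nonneg_left ?_ hh0.le
          have e1 : 0 ≤ S' (U (x₁ - j * h) x' t) * ∑ i : Fin n,
            (Du' (x₁ - j * h) x' t (EuclideanSpace.single i (1:ℝ))) ^ 2 :=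
            mul_nonneg (hSderiv_nonneg _) (Finset.sum_nonneg fun i _ => sq_nonneg _)
          have e2 : S (U (x₁ - j * h) x' t) * f (x₁ - j * h) x' t ≤ 1 * Mf :=
            mul_le_mul (hS1 _) (hf1 _ _ _ htt) (hf0 _ _ _ htt) zero_le_one
          linarith
      rw [Finset.sum_sub_distrib]
      have : ∑ j ∈ Finset.range K, h * Mf = L * Mf := by simp; rw [← hKh]; ring
      rw [this]
      linarith
  · intro x₁ hx₁ x' hx'
    refine (hWle _ x₁ hx₁ x' δ ⟨le_rfl, by linarith⟩
      (fun y hy => hUt3 y hy x' hx' δ ⟨hδ.le, hδ3⟩)).trans (le_of_eq ?_)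
    field_simp
  · intro x₁ hx₁ x' hx' t ht
    have e1 := hWle _ x₁ hx₁ x' t ht
      (fun y hy => hUt2 y hy x' hx' t ⟨by linarith [ht.1], ht.2.trans ht02⟩)
    have e2 : L * (k * ρ ^ 2 / (2 * L)) = k * ρ ^ 2 / 2 := by field_simp
    have e3 : c0 * (t - δ) ≤ c0 * t0 := by
      have : 0 < c0 := by positivity
      gcongr
      linarith [ht.2]
    linarith
  · rw [hkn]; linarith

/-- **No formation of a new phase, multi-dimensional graph case.**
For `N ≥ 2`, write `x = (x₁, x') ∈ ℝ × ℝ^{N-1}`. Given `T > 0`, `α > 0`, a non-negative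
bounded measurable heat source `f`, and an initial boundary graph `s₀ : ℝ^{N-1} → ℝ` of
class `C²` with bounded derivatives up to second order, there is no pair `(u, s)` such
that `s` is `C¹` in `t` and `C²` in `x'` on `(0,T)`, converges to `s₀` in the uniform `C²`
topology as `t ↓ 0`, has `s, ∇s, ∇²s` bounded on `ℝ^{N-1} × (0,T)` and `ṡ` bounded on
`ℝ^{N-1} × (δ,T)` for each `δ > 0`, and `u` is a non-negative bounded classical solution
of `∂ₜu - Δu = f` on the moving domain `{x₁ > s(t,x')}`, continuous together with `∇u` up
to the lateral boundary, with `u = 0` and `∂u/∂ν = -α` (equivalently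
`∂_{x₁}u = α/√(1+|∇'s|²)`) on the graph `x₁ = s(t,x')`, continuous up to `t = 0` with
`u(·,0) ≡ 0`.  Here `u₁, u₁₁` are the first and second `x₁`-derivatives and `Du', D2u'`
the first and second Fréchet derivatives of `u` in `x'`, so that
`Δu = u₁₁ + ∑ i, D2u' eᵢ eᵢ`. -/
theorem no_new_phase_multi_dimensional
    (N : ℕ) (hN : 2 ≤ N)
    (T α : ℝ) (hT : 0 < T) (hα : 0 < α)
    (f : ℝ → EuclideanSpace ℝ (Fin (N - 1)) → ℝ → ℝ)
    (hf_nonneg : ∀ (x₁ : ℝ) (x' : EuclideanSpace ℝ (Fin (N - 1))), ∀ t ∈ Ioo 0 T,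
      0 ≤ f x₁ x' t)
    (hf_bdd : ∃ M : ℝ, ∀ (x₁ : ℝ) (x' : EuclideanSpace ℝ (Fin (N - 1))), ∀ t ∈ Ioo 0 T,
      f x₁ x' t ≤ M)
    (hf_meas : Measurable fun p : ℝ × EuclideanSpace ℝ (Fin (N - 1)) × ℝ =>
      f p.1 p.2.1 p.2.2)
    (s₀ : EuclideanSpace ℝ (Fin (N - 1)) → ℝ)
    (hs₀ : ContDiff ℝ 2 s₀)
    (hs₀_bdd : ∃ M : ℝ, ∀ x' : EuclideanSpace ℝ (Fin (N - 1)),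
      ‖fderiv ℝ s₀ x'‖ ≤ M ∧ ‖fderiv ℝ (fderiv ℝ s₀) x'‖ ≤ M) :
    ¬ ∃ (u : ℝ → EuclideanSpace ℝ (Fin (N - 1)) → ℝ → ℝ)
        (s : ℝ → EuclideanSpace ℝ (Fin (N - 1)) → ℝ)
        (u₁ u₁₁ : ℝ → EuclideanSpace ℝ (Fin (N - 1)) → ℝ → ℝ)
        (Du' : ℝ → EuclideanSpace ℝ (Fin (N - 1)) → ℝ →
          (EuclideanSpace ℝ (Fin (N - 1)) →L[ℝ] ℝ))
        (D2u' : ℝ → EuclideanSpace ℝ (Fin (N - 1)) → ℝ →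
          (EuclideanSpace ℝ (Fin (N - 1)) →L[ℝ] EuclideanSpace ℝ (Fin (N - 1)) →L[ℝ] ℝ)),
      -- s is C² in x' for each t ∈ (0,T)
      (∀ t ∈ Ioo 0 T, ContDiff ℝ 2 (fun x' => s t x')) ∧
      -- s is C¹ in t on (0,T)
      (∀ x' : EuclideanSpace ℝ (Fin (N - 1)), ∀ t ∈ Ioo 0 T,
        DifferentiableAt ℝ (fun τ => s τ x') t) ∧
      (∀ x' : EuclideanSpace ℝ (Fin (N - 1)),
        ContinuousOn (deriv (fun τ => s τ x')) (Ioo 0 T)) ∧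
      -- extension of s to t = 0 by s₀
      (∀ x' : EuclideanSpace ℝ (Fin (N - 1)), s 0 x' = s₀ x') ∧
      -- s(t,·) → s₀ in the uniform C² topology as t ↓ 0
      (∀ ε > 0, ∃ δ > 0, ∀ t ∈ Ioo 0 T, t < δ →
        ∀ x' : EuclideanSpace ℝ (Fin (N - 1)),
          |s t x' - s₀ x'| ≤ ε ∧
          ‖fderiv ℝ (fun y => s t y) x' - fderiv ℝ s₀ x'‖ ≤ ε ∧
          ‖fderiv ℝ (fderiv ℝ (fun y => s t y)) x' - fderiv ℝ (fderiv ℝ s₀) x'‖ ≤ ε) ∧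
      -- s, ∇s, ∇²s bounded on ℝ^{N-1} × (0,T)
      (∃ M : ℝ, ∀ t ∈ Ioo 0 T, ∀ x' : EuclideanSpace ℝ (Fin (N - 1)),
        |s t x'| ≤ M ∧ ‖fderiv ℝ (fun y => s t y) x'‖ ≤ M ∧
        ‖fderiv ℝ (fderiv ℝ (fun y => s t y)) x'‖ ≤ M) ∧
      -- ṡ bounded on ℝ^{N-1} × (δ,T) for each δ > 0
      (∀ δ ∈ Ioo 0 T, ∃ M : ℝ, ∀ t ∈ Ioo δ T, ∀ x' : EuclideanSpace ℝ (Fin (N - 1)),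
        |deriv (fun τ => s τ x') t| ≤ M) ∧
      -- u is a classical solution of the heat equation ∂ₜ u - Δu = f in the moving domain
      (∀ t ∈ Ioo 0 T, ∀ x' : EuclideanSpace ℝ (Fin (N - 1)), ∀ x₁ : ℝ, s t x' < x₁ →
        HasDerivAt (fun ξ => u ξ x' t) (u₁ x₁ x' t) x₁ ∧
        HasDerivAt (fun ξ => u₁ ξ x' t) (u₁₁ x₁ x' t) x₁ ∧
        HasFDerivAt (fun y => u x₁ y t) (Du' x₁ x' t) x' ∧
        HasFDerivAt (fun y => Du' x₁ y t) (D2u' x₁ x' t) x' ∧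
        HasDerivAt (fun τ => u x₁ x' τ)
          (u₁₁ x₁ x' t +
            (∑ i : Fin (N - 1),
              D2u' x₁ x' t (EuclideanSpace.single i (1 : ℝ))
                (EuclideanSpace.single i (1 : ℝ))) + f x₁ x' t) t) ∧
      -- u is non-negative on the closed moving domain
      (∀ t ∈ Ioo 0 T, ∀ x' : EuclideanSpace ℝ (Fin (N - 1)), ∀ x₁ : ℝ,
        s t x' ≤ x₁ → 0 ≤ u x₁ x' t) ∧
      -- u is bounded
      (∃ M : ℝ, ∀ t ∈ Ioo 0 T, ∀ x' : EuclideanSpace ℝ (Fin (N - 1)), ∀ x₁ : ℝ,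
        s t x' ≤ x₁ → u x₁ x' t ≤ M) ∧
      -- u is continuous up to the lateral boundary and up to t = 0
      ContinuousOn (fun p : ℝ × EuclideanSpace ℝ (Fin (N - 1)) × ℝ => u p.1 p.2.1 p.2.2)
        {p : ℝ × EuclideanSpace ℝ (Fin (N - 1)) × ℝ |
          p.2.2 ∈ Ico 0 T ∧ s p.2.2 p.2.1 ≤ p.1} ∧
      -- ∇u is continuous up to the lateral boundary
      ContinuousOn (fun p : ℝ × EuclideanSpace ℝ (Fin (N - 1)) × ℝ => u₁ p.1 p.2.1 p.2.2)
        {p : ℝ × EuclideanSpace ℝ (Fin (N - 1)) × ℝ |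
          p.2.2 ∈ Ioo 0 T ∧ s p.2.2 p.2.1 ≤ p.1} ∧
      ContinuousOn (fun p : ℝ × EuclideanSpace ℝ (Fin (N - 1)) × ℝ => Du' p.1 p.2.1 p.2.2)
        {p : ℝ × EuclideanSpace ℝ (Fin (N - 1)) × ℝ |
          p.2.2 ∈ Ioo 0 T ∧ s p.2.2 p.2.1 ≤ p.1} ∧
      -- Dirichlet boundary condition u = 0 on x₁ = s(t,x')
      (∀ t ∈ Ioo 0 T, ∀ x' : EuclideanSpace ℝ (Fin (N - 1)), u (s t x') x' t = 0) ∧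
      -- exterior normal derivative condition ∂u/∂ν = -α, equivalently
      -- ∂_{x₁} u = α / √(1 + |∇_{x'} s|²) on x₁ = s(t,x')
      (∀ t ∈ Ioo 0 T, ∀ x' : EuclideanSpace ℝ (Fin (N - 1)),
        u₁ (s t x') x' t = α / Real.sqrt (1 + ‖fderiv ℝ (fun y => s t y) x'‖ ^ 2)) ∧
      -- zero initial value on the initial domain
      (∀ x' : EuclideanSpace ℝ (Fin (N - 1)), ∀ x₁ : ℝ, s₀ x' ≤ x₁ → u x₁ x' 0 = 0) := by
  rintro ⟨u, s, u₁, u₁₁, Du', D2u', hsC2, hsd, -, hs0, hconv, ⟨Ms, hMs⟩, -, hpde, hpos, -, hu, hu₁,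
    -, hdir, hneu, hini⟩
  obtain ⟨Mf, hMf⟩ := hf_bdd
  have hlip : ∀ t ∈ Ioo 0 T, ∀ x y : EuclideanSpace ℝ (Fin (N - 1)),
      |s t y - s t x| ≤ Ms * ‖y - x‖ := by
    intro t ht x y
    exact convex_univ.norm_image_sub_le_of_norm_fderiv_le (𝕜 := ℝ) (f := fun y => s t y)
      (fun w _ => ((hsC2 t ht).differentiable (by norm_num)) w) (fun w _ => (hMs t ht w).2.1)
      (mem_univ x) (mem_univ y)
  have hs : ContinuousOn (fun p : EuclideanSpace ℝ (Fin (N - 1)) × ℝ => s p.2 p.1)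
      (univ ×ˢ Ico 0 T) := by
    rintro ⟨x, t⟩ ⟨-, ht0, htT⟩
    simp only at ht0 htT
    rcases ht0.eq_or_lt with h | h
    · subst h
      rw [Metric.continuousWithinAt_iff]
      intro ε hε
      obtain ⟨δ, hδ, hd⟩ := hconv (ε / 2) (by positivity)
      obtain ⟨δ', hδ', hd'⟩ := Metric.continuous_iff.1 hs₀.continuous x (ε / 2) (by positivity)
      refine ⟨min δ δ', lt_min hδ hδ', ?_⟩
      rintro ⟨y, τ⟩ ⟨-, hτ0, hτT⟩ hdist
      simp only at hτ0 hτT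
      rw [Prod.dist_eq] at hdist
      have h1 : dist y x < δ' := (le_max_left _ _).trans_lt (hdist.trans_le (min_le_right _ _))
      have h2 : dist τ 0 < δ := (le_max_right _ _).trans_lt (hdist.trans_le (min_le_left _ _))
      have h3 := hd' y h1
      have h4 : |s τ y - s₀ y| ≤ ε / 2 := by
        rcases hτ0.eq_or_lt with h | h
        · rw [← h, hs0]; simp; positivity
        · refine (hd τ ⟨h, hτT⟩ ?_ y).1
          rw [Real.dist_eq, sub_zero] at h2
          exact (le_abs_self _).trans_lt h2
      simp only [hs0]
      rw [Real.dist_eq] at h3 ⊢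
      rw [abs_le] at h4
      rw [abs_lt] at h3 ⊢
      constructor <;> linarith [h3.1, h3.2, h4.1, h4.2]
    · apply ContinuousAt.continuousWithinAt
      have h1 : ContinuousAt (fun p : EuclideanSpace ℝ (Fin (N - 1)) × ℝ => s p.2 x) (x, t) :=
        ContinuousAt.comp (g := fun τ => s τ x) (f := fun p : EuclideanSpace ℝ (Fin (N - 1)) × ℝ => p.2)
          (hsd x t ⟨h, htT⟩).continuousAt continuousAt_snd
      have h2 : Tendsto (fun p : EuclideanSpace ℝ (Fin (N - 1)) × ℝ => s p.2 p.1 - s p.2 x)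
          (nhds (x, t)) (nhds 0) := by
        have hc : Continuous fun p : EuclideanSpace ℝ (Fin (N - 1)) × ℝ => Ms * ‖p.1 - x‖ := by
          fun_prop
        have hc0 := hc.tendsto (x, t)
        simp only [sub_self, norm_zero, mul_zero] at hc0
        refine squeeze_zero_norm' ?_ hc0
        have : ∀ᶠ p : EuclideanSpace ℝ (Fin (N - 1)) × ℝ in nhds (x, t), p.2 ∈ Ioo 0 T :=
          continuousAt_snd.eventually_mem (Ioo_mem_nhds h htT)
        filter_upwards [this] with p hp
        exact hlip p.2 hp x p.1
      have h3 := h2.add h1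
      simpa [ContinuousAt] using h3
  have hMs0 : 0 ≤ Ms := (norm_nonneg _).trans (hMs (T/2) ⟨by linarith, by linarith⟩ 0).2.1
  have hp : 0 < Real.sqrt (1 + Ms ^ 2) := Real.sqrt_pos.2 (by positivity)
  refine core_false T (max Mf 0) (α / Real.sqrt (1 + Ms ^ 2)) hT (by positivity) (le_max_right _ _) f
    hf_nonneg (fun x₁ x' t ht => (hMf x₁ x' t ht).trans (le_max_left _ _)) u s u₁ u₁₁ Du' D2u' hs
    hpde hpos hu hu₁ hdir ?_ ?_
  · intro t ht x'
    rw [hneu t ht x']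
    have := (hMs t ht x').2.1
    have hq : 0 < Real.sqrt (1 + ‖fderiv ℝ (fun y => s t y) x'‖ ^ 2) :=
      Real.sqrt_pos.2 (by positivity)
    gcongr
  · intro x' x₁ hx
    exact hini x' x₁ (by rwa [hs0] at hx)
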